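/- arXiv:1201.3291 — 3 statements merged into one kernel-verified Lean document; each statement's English description precedes it below -/
import Mathlib

section
/- A k-blocking set in PG(n,q) of size smaller than 2q^k contains a unique minimal k-blocking set. -/
open scoped Classical

noncomputable section

/-- The point set of `PG(n,q)`, `q = p^h`: the projectivization of `F_q^{n+1}`. -/
abbrev PGPoint (p h n : ℕ) [Fact p.Prime] :=
  Projectivization (GaloisField p h) (Fin (n+1) → GaloisField p h)

noncomputable instance (p h n : ℕ) [Fact p.Prime] : Fintype (PGPoint p h n) :=
  @Fintype.ofFinite _ (Quotient.finite _)

/-- A finite set of points of `PG(n,q)` is a `k`-blocking set if it meets every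
`(n-k)`-dimensional subspace. -/
def IsKBlockingSet (p h n k : ℕ) [Fact p.Prime] (B : Finset (PGPoint p h n)) : Prop :=
  ∀ S : Submodule (GaloisField p h) (Fin (n+1) → GaloisField p h),
    Module.finrank (GaloisField p h) S = n - k + 1 → ∃ P ∈ B, P.submodule ≤ S

/-- A minimal `k`-blocking set: no proper subset is a `k`-blocking set. -/
def IsMinimalKBlockingSet (p h n k : ℕ) [Fact p.Prime]
    (B : Finset (PGPoint p h n)) : Prop :=
  IsKBlockingSet p h n k B ∧ ∀ B' ⊂ B, ¬ IsKBlockingSet p h n k B'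

/-- Affine covering bound in the plane (Jamison / Brouwer-Schrijver), polynomial form. -/
theorem cover_bound {K ι : Type*} [Field K] [Fintype K] (T : Finset ι) (φ α β : ι → K)
    (hφ : ∀ i ∈ T, φ i ≠ 0)
    (h : ∀ u v : K, (u ≠ 0 ∨ v ≠ 0) → ∃ i ∈ T, φ i + u * α i + v * β i = 0) :
    2 * (Fintype.card K - 1) ≤ T.card := by
  by_contra hlt
  push Not at hlt
  let F : MvPolynomial (Fin 2) K := ∏ i ∈ T, (MvPolynomial.C (φ i) +
    MvPolynomial.X 0 * MvPolynomial.C (α i) + MvPolynomial.X 1 * MvPolynomial.C (β i))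
  have hev : ∀ x : Fin 2 → K,
      MvPolynomial.eval x F = ∏ i ∈ T, (φ i + x 0 * α i + x 1 * β i) := by
    intro x
    simp [F, MvPolynomial.eval_prod]
  have hdeg : F.totalDegree ≤ T.card := by
    refine (MvPolynomial.totalDegree_finsetProd _ _).trans ?_
    refine (Finset.sum_le_card_nsmul _ _ 1 ?_).trans (by simp)
    intro i _
    have h0 : ∀ (j : Fin 2) (c : K),
        (MvPolynomial.X j * MvPolynomial.C c : MvPolynomial (Fin 2) K).totalDegree ≤ 1 := by
      intro j c
      refine (MvPolynomial.totalDegree_mul _ _).trans ?_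
      simp [MvPolynomial.totalDegree_X]
    refine (MvPolynomial.totalDegree_add _ _).trans (max_le ?_ (h0 _ _))
    refine (MvPolynomial.totalDegree_add _ _).trans (max_le ?_ (h0 _ _))
    simp
  have hsum := MvPolynomial.sum_eval_eq_zero F (by
    simp only [Fintype.card_fin]
    omega)
  rw [Finset.sum_eq_single (0 : Fin 2 → K)] at hsum
  · rw [hev] at hsum
    obtain ⟨i, hi, h0⟩ := Finset.prod_eq_zero_iff.1 hsum
    exact hφ i hi (by simpa using h0)
  · intro x _ hx
    rw [hev]
    have : x 0 ≠ 0 ∨ x 1 ≠ 0 := by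
      by_contra hc
      push Not at hc
      apply hx
      ext j
      fin_cases j
      · exact hc.1
      · exact hc.2
    obtain ⟨i, hi, h0⟩ := h _ _ this
    exact Finset.prod_eq_zero hi h0
  · simp

section
variable {K V : Type*} [Field K] [AddCommGroup V] [Module K V] [FiniteDimensional K V]

theorem finrank_inf_ker {U : Submodule K V} (ψ : V →ₗ[K] K) {w : V} (hw : w ∈ U)
    (hψ : ψ w ≠ 0) :
    Module.finrank K (U ⊓ LinearMap.ker ψ : Submodule K V) + 1 = Module.finrank K U := by
  have hn : w ∉ U ⊓ LinearMap.ker ψ := fun h => hψ h.2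
  rw [← Submodule.finrank_sup_span_singleton hn]
  have : (U ⊓ LinearMap.ker ψ) ⊔ Submodule.span K {w} = U := by
    apply le_antisymm
    · exact sup_le inf_le_left ((Submodule.span_singleton_le_iff_mem _ _).2 hw)
    · intro x hx
      rw [Submodule.mem_sup]
      refine ⟨x - (ψ x / ψ w) • w, ⟨U.sub_mem hx (U.smul_mem _ hw), ?_⟩, (ψ x / ψ w) • w,
        Submodule.smul_mem _ _ (Submodule.mem_span_singleton_self w), by simp⟩
      change ψ _ = 0
      simp [hψ]
  rw [this]

theorem hit_lemma (A : Finset (Projectivization K V)) (d : ℕ) (W : Submodule K V)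
    (hW : Module.finrank K W = d) (P R : Projectivization K V)
    (hPW : P.rep ∈ W) (hRW : R.rep ∈ W)
    (hAW : ∀ Q ∈ A, Q.rep ∈ W → Q = P)
    (hblock : ∀ S : Submodule K V, Module.finrank K S = d → ∃ Q ∈ A, Q.rep ∈ S)
    (hno : ∀ S : Submodule K V, Module.finrank K S = d → P.rep ∈ S → R.rep ∉ S →
      ∃ Q ∈ A, Q ≠ P ∧ Q.rep ∈ S)
    (w : V) (hw : w ∉ W) (ψ : V →ₗ[K] K) (hψ : ψ w ≠ 0)
    (hPR : ψ P.rep = 0 → ψ R.rep ≠ 0) :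
    ∃ Q ∈ A, Q.rep ∉ W ∧ Q.rep ∈ W ⊔ Submodule.span K {w} ∧ ψ Q.rep = 0 := by
  have hwU : w ∈ W ⊔ Submodule.span K {w} :=
    Submodule.mem_sup_right (Submodule.mem_span_singleton_self w)
  have hd : Module.finrank K
      ((W ⊔ Submodule.span K {w}) ⊓ LinearMap.ker ψ : Submodule K V) = d := by
    have h1 := finrank_inf_ker ψ hwU hψ
    rw [Submodule.finrank_sup_span_singleton hw, hW] at h1
    omega
  obtain ⟨Q, hQA, hQ⟩ := hblock _ hd
  by_cases hQW : Q.rep ∈ W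
  · have hQP := hAW Q hQA hQW
    subst hQP
    obtain ⟨Q', hA', hne, hQ'⟩ := hno _ hd hQ (fun h => hPR hQ.2 h.2)
    exact ⟨Q', hA', fun h => hne (hAW _ hA' h), hQ'.1, hQ'.2⟩
  · exact ⟨Q, hQA, hQW, hQ.1, hQ.2⟩

theorem notMem_span_pair (W : Submodule K V) (P R : Projectivization K V) (hPR : P ≠ R)
    (hPW : P.rep ∈ W) (hRW : R.rep ∈ W) (w : V) (hw : w ∉ W) :
    P.rep ∉ Submodule.span K {R.rep, w} := by
  intro h
  obtain ⟨a, b, hab⟩ := Submodule.mem_span_pair.1 h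
  by_cases hb : b = 0
  · apply hPR
    rw [← P.mk_rep, ← R.mk_rep, Projectivization.mk_eq_mk_iff']
    exact ⟨a, by simpa [hb] using hab⟩
  · apply hw
    have : b • w ∈ W := by
      have : b • w = P.rep - a • R.rep := by rw [← hab]; abel
      rw [this]
      exact W.sub_mem hPW (W.smul_mem _ hRW)
    exact (W.smul_mem_iff hb).1 this

theorem exists_functional (W : Submodule K V) (P R : Projectivization K V) (hPR : P ≠ R)
    (hPW : P.rep ∈ W) (hRW : R.rep ∈ W) (w : V) (hw : w ∉ W) :
    ∃ α : V →ₗ[K] K, α P.rep ≠ 0 ∧ α R.rep = 0 ∧ α w = 0 := by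
  obtain ⟨f, hf, hle⟩ :=
    Submodule.exists_le_ker_of_notMem (notMem_span_pair W P R hPR hPW hRW w hw)
  exact ⟨f, hf, hle (Submodule.subset_span (by simp)), hle (Submodule.subset_span (by simp))⟩

theorem plane_count [Fintype K] (A : Finset (Projectivization K V)) (d : ℕ) (W : Submodule K V)
    (hW : Module.finrank K W = d) (P R : Projectivization K V) (hne : P ≠ R)
    (hPW : P.rep ∈ W) (hRW : R.rep ∈ W)
    (hAW : ∀ Q ∈ A, Q.rep ∈ W → Q = P)
    (hblock : ∀ S : Submodule K V, Module.finrank K S = d → ∃ Q ∈ A, Q.rep ∈ S)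
    (hno : ∀ S : Submodule K V, Module.finrank K S = d → P.rep ∈ S → R.rep ∉ S →
      ∃ Q ∈ A, Q ≠ P ∧ Q.rep ∈ S)
    (w : V) (hw : w ∉ W) :
    2 * Fintype.card K - 1 ≤
      (A.filter (fun Q => Q.rep ∉ W ∧ Q.rep ∈ W ⊔ Submodule.span K {w})).card := by
  have hit := hit_lemma A d W hW P R hPW hRW hAW hblock hno
  -- a first point `Q₀`
  obtain ⟨Q₀, hQ₀A, hQ₀W, hQ₀U⟩ : ∃ Q ∈ A, Q.rep ∉ W ∧ Q.rep ∈ W ⊔ Submodule.span K {w} := by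
    obtain ⟨α, hα, -, hαw⟩ := exists_functional W P R hne hPW hRW w hw
    obtain ⟨φ, hφ, hφW⟩ := Submodule.exists_le_ker_of_notMem hw
    obtain ⟨Q, h1, h2, h3, -⟩ := hit w hw (φ + α) (by simpa [hαw] using hφ) (by
      intro h
      have : φ P.rep = 0 := hφW hPW
      simp [this, hα] at h)
    exact ⟨Q, h1, h2, h3⟩
  obtain ⟨α, hα, hαR, hα0⟩ := exists_functional W P R hne hPW hRW _ hQ₀W
  obtain ⟨β, hβ, hβP, hβ0⟩ := exists_functional W R P hne.symm hRW hPW _ hQ₀W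
  obtain ⟨φ, hφ, hφW⟩ := Submodule.exists_le_ker_of_notMem hQ₀W
  have hφP : φ P.rep = 0 := hφW hPW
  have hφR : φ R.rep = 0 := hφW hRW
  have hUle : W ⊔ Submodule.span K {Q₀.rep} ≤ W ⊔ Submodule.span K {w} :=
    sup_le le_sup_left ((Submodule.span_singleton_le_iff_mem _ _).2 hQ₀U)
  have hUeq : W ⊔ Submodule.span K {Q₀.rep} = W ⊔ Submodule.span K {w} := by
    apply Submodule.eq_of_le_of_finrank_eq hUle
    rw [Submodule.finrank_sup_span_singleton hw, Submodule.finrank_sup_span_singleton hQ₀W]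
  set T := A.filter (fun Q => Q.rep ∉ W ∧ Q.rep ∈ W ⊔ Submodule.span K {w}) with hT
  have hQT : Q₀ ∈ T := by simp [hT, hQ₀A, hQ₀W, hQ₀U]
  have hb := cover_bound (T.erase Q₀) (fun Q => φ Q.rep) (fun Q => α Q.rep) (fun Q => β Q.rep)
    (by
      intro Q hQ h0
      have hQ' := (Finset.mem_filter.1 (Finset.mem_of_mem_erase hQ)).2
      rw [← hUeq] at hQ'
      obtain ⟨y, hy, z, hz, hyz⟩ := Submodule.mem_sup.1 hQ'.2
      obtain ⟨c, rfl⟩ := Submodule.mem_span_singleton.1 hz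
      have hφy : φ y = 0 := hφW hy
      simp only [← hyz, map_add, map_smul, hφy, zero_add, smul_eq_mul, mul_eq_zero, hφ,
        or_false] at h0
      apply hQ'.1
      rw [← hyz, h0]
      simpa using hy)
    (by
      intro u v huv
      obtain ⟨Q, h1, h2, h3, h4⟩ := hit Q₀.rep hQ₀W (φ + u • α + v • β)
        (by simpa [hα0, hβ0] using hφ)
        (by
          intro hP hR
          simp [hφP, hβP, hα] at hP
          simp [hφR, hαR, hβ] at hR
          rcases huv with h | h
          · exact h hP
          · exact h hR)
      refine ⟨Q, Finset.mem_erase.2 ⟨?_, ?_⟩, by simpa using h4⟩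
      · rintro rfl
        simp [hα0, hβ0, hφ] at h4
      · rw [hUeq] at h3
        exact Finset.mem_filter.2 ⟨h1, h2, h3⟩)
  rw [Finset.card_erase_of_mem hQT] at hb
  have h1 : 1 < Fintype.card K := Fintype.one_lt_card
  have h2 : 0 < T.card := Finset.card_pos.2 ⟨_, hQT⟩
  omega

theorem geom_bound (q k : ℕ) (hq : 1 ≤ q) (hk : 1 ≤ k) :
    2 * q ^ k ≤ (2 * q - 1) * (∑ i ∈ Finset.range k, q ^ i) + 1 := by
  obtain ⟨m, hm⟩ : ∃ m, 2 * q = m + 1 := ⟨2 * q - 1, by omega⟩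
  have hm' : 2 * q - 1 = m := by omega
  rw [hm']
  induction k, hk using Nat.le_induction with
  | base => simp; omega
  | succ k hk ih =>
    rw [Finset.sum_range_succ, mul_add, pow_succ]
    have h1 : 2 * (q ^ k * q) = q ^ k * (m + 1) := by rw [← hm]; ring
    have : 0 < q ^ k := by positivity
    rw [h1]
    nlinarith

theorem extend_lemma [Fintype K] (A : Finset (Projectivization K V)) (d k : ℕ) (hk : 1 ≤ k)
    (hV : Module.finrank K V = d + k)
    (hcard : A.card < 2 * Fintype.card K ^ k)
    (W : Submodule K V) (hW : Module.finrank K W = d) (P R : Projectivization K V) (hne : P ≠ R)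
    (hPA : P ∈ A)
    (hPW : P.rep ∈ W)
    (hAW : ∀ Q ∈ A, Q.rep ∈ W → Q = P)
    (hblock : ∀ S : Submodule K V, Module.finrank K S = d → ∃ Q ∈ A, Q.rep ∈ S) :
    ∃ S : Submodule K V, Module.finrank K S = d ∧ P.rep ∈ S ∧ R.rep ∉ S ∧
      ∀ Q ∈ A, Q.rep ∈ S → Q = P := by
  by_cases hRW : R.rep ∈ W
  swap
  · exact ⟨W, hW, hPW, hRW, hAW⟩
  by_contra hcon
  push Not at hcon
  have hno : ∀ S : Submodule K V, Module.finrank K S = d → P.rep ∈ S → R.rep ∉ S →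
      ∃ Q ∈ A, Q ≠ P ∧ Q.rep ∈ S := by
    intro S h1 h2 h3
    obtain ⟨Q, a, b, c⟩ := hcon S h1 h2 h3
    exact ⟨Q, a, c, b⟩
  have hpl := plane_count A d W hW P R hne hPW hRW hAW hblock hno
  have hquot : Module.finrank K (V ⧸ W) = k := by
    have := W.finrank_quotient_add_finrank
    omega
  haveI : Finite (V ⧸ W) := Module.finite_of_finite K
  haveI : Finite (Projectivization K (V ⧸ W)) := Quotient.finite _
  letI : Fintype (Projectivization K (V ⧸ W)) := Fintype.ofFinite _
  have hcq := Projectivization.card_of_finrank K (V ⧸ W) hquot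
  have hkpos : 0 < Module.finrank K (V ⧸ W) := by omega
  haveI : Nontrivial (V ⧸ W) := Module.nontrivial_of_finrank_pos hkpos
  obtain ⟨x₀, hx₀⟩ := exists_ne (0 : V ⧸ W)
  let f : Projectivization K V → Projectivization K (V ⧸ W) := fun Q =>
    if h : W.mkQ Q.rep ≠ 0 then Projectivization.mk K (W.mkQ Q.rep) h
    else Projectivization.mk K x₀ hx₀
  have hmain : (2 * Fintype.card K - 1) * (Finset.univ : Finset (Projectivization K (V ⧸ W))).card
      ≤ (A.erase P).card := by
    apply Finset.mul_card_image_le_card_of_maps_to (f := f) (fun _ _ => Finset.mem_univ _)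
    intro b _
    obtain ⟨w, hwb⟩ := W.mkQ_surjective b.rep
    have hw : w ∉ W := by
      intro h
      apply b.rep_nonzero
      rw [← hwb]
      simpa using h
    refine (hpl w hw).trans (Finset.card_le_card ?_)
    intro Q hQ
    obtain ⟨h1, h2, h3⟩ := Finset.mem_filter.1 hQ
    refine Finset.mem_filter.2 ⟨Finset.mem_erase.2 ⟨?_, h1⟩, ?_⟩
    · rintro rfl
      exact h2 hPW
    · have h0 : W.mkQ Q.rep ≠ 0 := by simpa using h2
      simp only [f]
      rw [dif_pos h0, ← b.mk_rep, Projectivization.mk_eq_mk_iff']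
      obtain ⟨y, hy, z, hz, hyz⟩ := Submodule.mem_sup.1 h3
      obtain ⟨c, rfl⟩ := Submodule.mem_span_singleton.1 hz
      refine ⟨c, ?_⟩
      have hy0 : W.mkQ y = 0 := by simpa using hy
      rw [← hyz, map_add, map_smul, hy0, hwb, zero_add]
  rw [Finset.card_univ, Fintype.card_eq_nat_card (α := Projectivization K (V ⧸ W)), hcq,
    Nat.card_eq_fintype_card,
    Finset.card_erase_of_mem hPA] at hmain
  have hg := geom_bound (Fintype.card K) k Fintype.card_pos hk
  have : 0 < A.card := Finset.card_pos.2 ⟨_, hPA⟩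
  omega

theorem tangent_lemma [Fintype K] (d k : ℕ) (hk : 1 ≤ k)
    (hV : Module.finrank K V = d + k) (M : Finset (Projectivization K V))
    (hblock : ∀ S : Submodule K V, Module.finrank K S = d → ∃ Q ∈ M, Q.rep ∈ S)
    (P : Projectivization K V) (hP : P ∈ M)
    (W : Submodule K V) (hW : Module.finrank K W = d) (hPW : P.rep ∈ W)
    (hMW : ∀ Q ∈ M, Q.rep ∈ W → Q = P) (C : Finset (Projectivization K V)) :
    (M ∪ C).card < 2 * Fintype.card K ^ k →
    ∃ S : Submodule K V, Module.finrank K S = d ∧ P.rep ∈ S ∧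
      ∀ Q ∈ M ∪ C, Q.rep ∈ S → Q = P := by
  induction C using Finset.induction_on with
  | empty => intro _; exact ⟨W, hW, hPW, by simpa using hMW⟩
  | insert R C hR ih =>
    intro hc
    have hsub : M ∪ C ⊆ M ∪ insert R C :=
      Finset.union_subset_union_right (Finset.subset_insert _ _)
    have hc' := (Finset.card_le_card hsub).trans_lt hc
    obtain ⟨S, h1, h2, h3⟩ := ih hc'
    by_cases hRP : P = R
    · refine ⟨S, h1, h2, fun Q hQ hQS => ?_⟩
      rw [Finset.union_insert, Finset.mem_insert] at hQ
      rcases hQ with h | h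
      · rw [h, hRP]
      · exact h3 Q h hQS
    · obtain ⟨S', a, b, c, e⟩ := extend_lemma (M ∪ C) d k hk hV hc' S h1 P R hRP
        (Finset.mem_union_left _ hP) h2 h3 (fun S hS => by
          obtain ⟨Q, hQ, hQS⟩ := hblock S hS
          exact ⟨Q, Finset.mem_union_left _ hQ, hQS⟩)
      refine ⟨S', a, b, fun Q hQ hQS => ?_⟩
      rw [Finset.union_insert, Finset.mem_insert] at hQ
      rcases hQ with h | h
      · exact absurd (h ▸ hQS) c
      · exact e Q h hQS

end

theorem submodule_le_iff_rep {K V : Type*} [Field K] [AddCommGroup V] [Module K V]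
    (P : Projectivization K V) (S : Submodule K V) : P.submodule ≤ S ↔ P.rep ∈ S := by
  rw [Projectivization.submodule_eq, Submodule.span_singleton_le_iff_mem]

theorem minimal_subset (p h n k : ℕ) [Fact p.Prime] (hh : 0 < h) (hk1 : 1 ≤ k) (hkn : k ≤ n)
    (B : Finset (PGPoint p h n))
    (hcard : B.card < 2 * (p ^ h) ^ k) (M M' : Finset (PGPoint p h n)) (hMB : M ⊆ B)
    (hM : IsMinimalKBlockingSet p h n k M) (hMB' : M' ⊆ B)
    (hM' : IsKBlockingSet p h n k M') : M ⊆ M' := by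
  intro P hP
  letI : Fintype (GaloisField p h) := Fintype.ofFinite _
  have hq : Fintype.card (GaloisField p h) = p ^ h := by
    rw [Fintype.card_eq_nat_card, GaloisField.card p h hh.ne']
  have hnot := hM.2 _ (Finset.erase_ssubset hP)
  simp only [IsKBlockingSet, submodule_le_iff_rep] at hnot
  push Not at hnot
  obtain ⟨W, hW, hWe⟩ := hnot
  have hbl : ∀ S : Submodule (GaloisField p h) (Fin (n+1) → GaloisField p h),
      Module.finrank (GaloisField p h) S = n - k + 1 → ∃ Q ∈ M, Q.rep ∈ S := by
    intro S hS
    obtain ⟨Q, h1, h2⟩ := hM.1 S hS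
    exact ⟨Q, h1, (submodule_le_iff_rep _ _).1 h2⟩
  have hMW : ∀ Q ∈ M, Q.rep ∈ W → Q = P := by
    intro Q hQ hQW
    by_contra hne
    exact hWe Q (Finset.mem_erase.2 ⟨hne, hQ⟩) hQW
  have hPW : P.rep ∈ W := by
    obtain ⟨Q, h1, h2⟩ := hbl W hW
    exact hMW Q h1 h2 ▸ h2
  obtain ⟨S, h1, -, h3⟩ := tangent_lemma (n - k + 1) k hk1
    (by rw [Module.finrank_fin_fun]; omega) M hbl P hP W hW hPW hMW B
    (by rw [Finset.union_eq_right.2 hMB, hq]; exact hcard)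
  obtain ⟨Q, hQ, hQS⟩ := hM' S h1
  have := h3 Q (Finset.mem_union_right _ (hMB' hQ)) ((submodule_le_iff_rep _ _).1 hQS)
  exact this ▸ hQ

/-- a `k`-blocking set of `PG(n,q)` of size `< 2q^k` contains a unique
minimal `k`-blocking set. -/
theorem stmt3 (p h n k : ℕ) [Fact p.Prime] (hh : 0 < h) (hk1 : 1 ≤ k) (hkn : k ≤ n)
    (B : Finset (PGPoint p h n)) (hB : IsKBlockingSet p h n k B)
    (hcard : B.card < 2 * (p ^ h) ^ k) :
    ∃! M : Finset (PGPoint p h n), M ⊆ B ∧ IsMinimalKBlockingSet p h n k M := by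
  obtain ⟨M, hMB, hM⟩ := exists_minimal_le_of_wellFoundedLT (IsKBlockingSet p h n k) B hB
  refine ⟨M, ⟨hMB, hM.prop, fun B' hB' hbl => ?_⟩, ?_⟩
  · exact hB'.2 (hM.le_of_le hbl hB'.1)
  · rintro M' ⟨hMB', hM'⟩
    apply Finset.Subset.antisymm
    · exact minimal_subset p h n k hh hk1 hkn B hcard M' M hMB' hM' hMB hM.prop
    · exact hM.le_of_le hM'.1
        (minimal_subset p h n k hh hk1 hkn B hcard M' M hMB' hM' hMB hM.prop)
end
end

section
/- If c ∈ C_k(n,q) ∩ C_k(n,q)^⊥ (no assumption on k versus n/2), then (c,S) = 0 for every (n−k)-space S of PG(n,q). -/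
open scoped Classical

noncomputable section

/-- Incidence vector (over `F_p`) of the point set of the projective subspace
determined by a submodule `W`. -/
def incVec (p h n : ℕ) [Fact p.Prime]
    (W : Submodule (GaloisField p h) (Fin (n+1) → GaloisField p h)) :
    PGPoint p h n → ZMod p :=
  fun P => if P.submodule ≤ W then 1 else 0

/-- The `p`-ary code `C_k(n,q)` generated by the incidence vectors of the
`k`-spaces (i.e. submodules of rank `k+1`) of `PG(n,q)`. -/
def PGCode (p h n k : ℕ) [Fact p.Prime] :
    Submodule (ZMod p) (PGPoint p h n → ZMod p) :=
  Submodule.span (ZMod p)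
    { c | ∃ W : Submodule (GaloisField p h) (Fin (n+1) → GaloisField p h),
        Module.finrank (GaloisField p h) W = k + 1 ∧ c = incVec p h n W }

/-- Standard inner product of two words over `F_p`. -/
def ip {X : Type*} [Fintype X] {p : ℕ} (c d : X → ZMod p) : ZMod p :=
  ∑ x, c x * d x

/-- The dual code of a code `C`. -/
def dualCode {X : Type*} [Fintype X] {p : ℕ}
    (C : Submodule (ZMod p) (X → ZMod p)) : Submodule (ZMod p) (X → ZMod p) where
  carrier := { v | ∀ c ∈ C, ip v c = 0 }
  zero_mem' := by intro c hc; simp [ip]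
  add_mem' := by
    intro a b ha hb c hc
    simp only [Set.mem_setOf_eq, ip, Pi.add_apply, add_mul, Finset.sum_add_distrib] at *
    rw [ha c hc, hb c hc, add_zero]
  smul_mem' := by
    intro r a ha c hc
    simp only [Set.mem_setOf_eq, ip, Pi.smul_apply, smul_eq_mul, mul_assoc, ← Finset.mul_sum] at *
    rw [ha c hc, mul_zero]

/-- Hamming weight of a word. -/
def wt {X : Type*} [Fintype X] {p : ℕ} (c : X → ZMod p) : ℕ :=
  (Finset.univ.filter fun x => c x ≠ 0).card

lemma aux_count (p h n : ℕ) [Fact p.Prime] (hh : 0 < h)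
    (W : Submodule (GaloisField p h) (Fin (n+1) → GaloisField p h)) (hW : W ≠ ⊥) :
    ∑ P, incVec p h n W P = 1 := by
  have hq : Nat.card (GaloisField p h) = p ^ h := GaloisField.card p h hh.ne'
  have : Finite (GaloisField p h) := Nat.finite_of_card_ne_zero (by
    rw [hq]; exact pow_ne_zero _ (Fact.out : p.Prime).ne_zero)
  have e1 : ∑ P, incVec p h n W P
      = (Nat.card (Projectivization (GaloisField p h) W) : ZMod p) := by
    unfold incVec
    rw [Finset.sum_boole]
    congr 1
    rw [← Fintype.card_subtype, ← Nat.card_eq_fintype_card]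
    symm
    refine Nat.card_congr (Equiv.ofBijective
      (fun x => ⟨Projectivization.map W.subtype W.injective_subtype x, ?_⟩) ⟨?_, ?_⟩)
    · induction x using Projectivization.ind with
      | h v hv =>
        rw [Projectivization.map_mk, Projectivization.submodule_mk]
        rw [Submodule.span_singleton_le_iff_mem]
        exact v.2
    · intro x y hxy
      exact Projectivization.map_injective W.subtype W.injective_subtype (Subtype.ext_iff.mp hxy)
    · rintro ⟨P, hP⟩
      induction P using Projectivization.ind with
      | h v hv =>
        have hvW : v ∈ W := by
          rwa [Projectivization.submodule_mk, Submodule.span_singleton_le_iff_mem] at hP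
        refine ⟨Projectivization.mk _ (⟨v, hvW⟩ : W) (fun h0 => hv (Subtype.ext_iff.mp h0)), ?_⟩
        apply Subtype.ext
        simp only [Projectivization.map_mk]
        rfl
  rw [e1]
  have hcard := Projectivization.card' (GaloisField p h) W
  have hWc : Nat.card W = Nat.card (GaloisField p h) ^ Module.finrank (GaloisField p h) W :=
    Module.natCard_eq_pow_finrank
  have hr : Module.finrank (GaloisField p h) W ≠ 0 := by
    rwa [Ne, Submodule.finrank_eq_zero]
  rw [hWc, hq] at hcard
  have h2 := congrArg (Nat.cast : ℕ → ZMod p) hcard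
  rw [Nat.cast_add, Nat.cast_mul, Nat.cast_sub (Nat.one_le_pow _ _ (Fact.out : p.Prime).pos)] at h2
  simp [hh.ne', hr] at h2
  linear_combination h2

lemma aux_rank {K V : Type*} [Field K] [AddCommGroup V] [Module K V] [FiniteDimensional K V]
    (A : Submodule K V) (P : Projectivization K V) (hP : ¬ P.submodule ≤ A) :
    Module.finrank K (A ⊔ P.submodule : Submodule K V) = Module.finrank K A + 1 := by
  have h1 := Submodule.finrank_sup_add_finrank_inf_eq A P.submodule
  have h2 := P.finrank_submodule
  have h3 : Module.finrank K (A ⊓ P.submodule : Submodule K V) = 0 := by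
    by_contra h0
    apply hP
    have h4 : A ⊓ P.submodule = P.submodule :=
      Submodule.eq_of_le_of_finrank_le inf_le_right (by omega)
    rw [← h4]; exact inf_le_left
  omega

lemma aux_exch {K V : Type*} [Field K] [AddCommGroup V] [Module K V] [FiniteDimensional K V]
    (A : Submodule K V) (P Q : Projectivization K V) (hP : ¬ P.submodule ≤ A)
    (hQ : ¬ Q.submodule ≤ A) (h : P.submodule ≤ A ⊔ Q.submodule) :
    Q.submodule ≤ A ⊔ P.submodule := by
  have : A ⊔ P.submodule = A ⊔ Q.submodule :=
    Submodule.eq_of_le_of_finrank_eq (sup_le le_sup_left h)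
      (by rw [aux_rank A P hP, aux_rank A Q hQ])
  rw [this]; exact le_sup_right

lemma aux_one (p h n k : ℕ) [Fact p.Prime] (hh : 0 < h) (hkn : k < n) :
    (fun _ => 1 : PGPoint p h n → ZMod p) ∈ PGCode p h n k := by
  obtain ⟨A, hA⟩ : ∃ A : Submodule (GaloisField p h) (Fin (n+1) → GaloisField p h),
      Module.finrank (GaloisField p h) A = k := by
    have hl := (Pi.basisFun (GaloisField p h) (Fin (n+1))).linearIndependent.comp
      (Fin.castLE (by omega : k ≤ n + 1)) (Fin.castLE_injective _)
    exact ⟨_, (finrank_span_eq_card hl).trans (by simp)⟩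
  obtain ⟨U, hU⟩ := Submodule.exists_isCompl A
  have hdim := Submodule.finrank_add_eq_of_isCompl hU
  rw [Module.finrank_fin_fun] at hdim
  have hQA : ∀ Q : PGPoint p h n, Q.submodule ≤ U → ¬ Q.submodule ≤ A := by
    intro Q hQ hQ'
    have := Q.finrank_submodule
    rw [le_bot_iff.mp (hU.disjoint hQ' hQ)] at this
    simp at this
  have key : (fun _ => 1 : PGPoint p h n → ZMod p)
      = ∑ Q, incVec p h n U Q • incVec p h n (A ⊔ Q.submodule) := by
    funext P
    rw [Finset.sum_apply]
    simp only [Pi.smul_apply, smul_eq_mul]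
    by_cases hP : P.submodule ≤ A
    · rw [← aux_count p h n hh U (by rintro rfl; simp at hdim; omega)]
      refine Finset.sum_congr rfl fun Q _ => ?_
      simp [incVec, hP.trans le_sup_left]
    · have hr := aux_rank A P hP
      rw [← aux_count p h n hh (U ⊓ (A ⊔ P.submodule)) ?_]
      · refine Finset.sum_congr rfl fun Q _ => ?_
        unfold incVec
        by_cases hQ : Q.submodule ≤ U
        · have : P.submodule ≤ A ⊔ Q.submodule ↔ Q.submodule ≤ A ⊔ P.submodule :=
            ⟨aux_exch A P Q hP (hQA Q hQ), aux_exch A Q P (hQA Q hQ) hP⟩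
          simp [hQ, this]
        · simp [hQ]
      · intro h0
        have h1 := Submodule.finrank_sup_add_finrank_inf_eq U (A ⊔ P.submodule)
        have h2 := Submodule.finrank_le (U ⊔ (A ⊔ P.submodule))
        rw [Module.finrank_fin_fun] at h2
        rw [h0, finrank_bot] at h1
        omega
  rw [key]
  refine Submodule.sum_mem _ fun Q _ => ?_
  by_cases hQ : Q.submodule ≤ U
  · refine Submodule.smul_mem _ _ (Submodule.subset_span ⟨_, ?_, rfl⟩)
    rw [aux_rank A Q (hQA Q hQ), hA]
  · simp [incVec, hQ]

/-- if `c ∈ C_k(n,q) ∩ C_k(n,q)^⊥` then `(c,S) = 0` for every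
`(n-k)`-space `S` of `PG(n,q)` (no assumption relating `k` and `n/2`). -/
theorem stmt12 (p h n k : ℕ) [Fact p.Prime] (hh : 0 < h) (hk1 : 1 ≤ k) (hkn : k < n)
    (c : PGPoint p h n → ZMod p)
    (hc : c ∈ PGCode p h n k ⊓ dualCode (PGCode p h n k)) :
    ∀ S : Submodule (GaloisField p h) (Fin (n+1) → GaloisField p h),
      Module.finrank (GaloisField p h) S = n - k + 1 → ip c (incVec p h n S) = 0 := by
  intro S hS
  have hd : ip c (fun _ => 1) = 0 := hc.2 _ (aux_one p h n k hh hkn)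
  have main : ∀ d ∈ PGCode p h n k, ip d (incVec p h n S) = ip d (fun _ => 1) := by
    intro d hd
    induction hd using Submodule.span_induction with
    | mem x hx =>
      obtain ⟨W, hW, rfl⟩ := hx
      have e1 : ip (incVec p h n W) (fun _ => 1) = 1 := by
        simp only [ip, mul_one]
        exact aux_count p h n hh W (by rintro rfl; simp at hW)
      have e2 : ip (incVec p h n W) (incVec p h n S) = 1 := by
        rw [← aux_count p h n hh (W ⊓ S) ?_]
        · refine Finset.sum_congr rfl fun Q _ => ?_
          simp only [incVec, le_inf_iff, ← ite_and, mul_ite, mul_one, mul_zero]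
          simp only [and_comm]
        · intro h0
          have h1 := Submodule.finrank_sup_add_finrank_inf_eq W S
          have h2 := Submodule.finrank_le (W ⊔ S)
          rw [Module.finrank_fin_fun] at h2
          rw [h0, finrank_bot] at h1
          omega
      rw [e1, e2]
    | zero => simp [ip]
    | add x y _ _ hx hy =>
      simp only [ip, Pi.add_apply, add_mul, Finset.sum_add_distrib] at *
      rw [hx, hy]
    | smul a x _ hx =>
      simp only [ip, Pi.smul_apply, smul_eq_mul, mul_assoc, ← Finset.mul_sum] at *
      rw [hx]
  rw [main c hc.1, hd]
end
end

section
/- For all n ≥ 2 and 0 < k ≤ n−1, the minimum weight of C_k(n,q)^⊥ equals the minimum weight of C_1(n−k+1,q)^⊥, the dual of the code of points and lines of PG(n−k+1,q). -/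
open scoped Classical

noncomputable section

/-- The minimum (Hamming) weight of a nonzero codeword of a code `C`. -/
def minWt {X : Type*} [Fintype X] {p : ℕ}
    (C : Submodule (ZMod p) (X → ZMod p)) : ℕ :=
  sInf { w | ∃ c ∈ C, c ≠ 0 ∧ wt c = w }

section aux

variable {p : ℕ} {K V U : Type} [Field K] [Fintype K] [AddCommGroup V] [Module K V]
  [Fintype V] [AddCommGroup U] [Module K U] [Fintype U]

/-- The sum of `f` over a subspace. -/
def sumOn (f : V → ZMod p) (W : Submodule K V) : ZMod p := ∑ v, if v ∈ W then f v else 0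

/-- Homogeneous lift of a dual codeword to the underlying vector space. -/
structure Good (K : Type) {V : Type} [Field K] [AddCommGroup V] [Module K V]
    [Fintype V] (k : ℕ) (f : V → ZMod p) : Prop where
  zero : f 0 = 0
  smul : ∀ (a : K) (v : V), a ≠ 0 → f (a • v) = f v
  sum : ∀ W : Submodule K V, Module.finrank K W = k + 1 → sumOn f W = 0

/-- Push-forward of a function. -/
def push (π : V →ₗ[K] U) (f : V → ZMod p) (w : U) : ZMod p := ∑ v, if π v = w then f v else 0

lemma push_sumOn (π : V →ₗ[K] U) (f : V → ZMod p) (W : Submodule K U) :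
    sumOn (push π f) W = sumOn f (W.comap π) := by
  unfold sumOn push
  have : ∀ w, (if w ∈ W then ∑ v, (if π v = w then f v else 0) else 0)
      = ∑ v, if π v = w then (if π v ∈ W then f v else 0) else 0 := by
    intro w
    split_ifs with h
    · refine Finset.sum_congr rfl fun v _ => ?_
      split_ifs with h1 h2 <;> simp_all
    · symm
      refine Finset.sum_eq_zero fun v _ => ?_
      split_ifs with h1 h2 <;> simp_all
  simp_rw [this]
  rw [Finset.sum_comm]
  simp

lemma push_wt (π : V →ₗ[K] U) (f : V → ZMod p) : wt (push π f) ≤ wt f := by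
  unfold wt
  refine le_trans (Finset.card_le_card (t := (Finset.univ.filter fun x => f x ≠ 0).image π) ?_)
    Finset.card_image_le
  intro w hw
  simp only [Finset.mem_filter, Finset.mem_univ, true_and, Finset.mem_image] at hw ⊢
  by_contra! hcon
  apply hw
  refine Finset.sum_eq_zero fun v _ => ?_
  split_ifs with h
  · by_contra h0
    exact hcon v h0 h
  · rfl

lemma push_smul (π : V →ₗ[K] U) (f : V → ZMod p)
    (hf : ∀ (a : K) (v : V), a ≠ 0 → f (a • v) = f v) (a : K) (w : U) (ha : a ≠ 0) :
    push π f (a • w) = push π f w := by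
  unfold push
  symm
  refine Fintype.sum_equiv (LinearEquiv.smulOfNeZero K V a ha).toEquiv _ _ fun v => ?_
  have : π ((LinearEquiv.smulOfNeZero K V a ha) v) = a • π v := by simp
  simp [hf a v ha, (smul_right_injective U ha).eq_iff]

lemma finrank_comap_surj (π : V →ₗ[K] U) (hπ : Function.Surjective π)
    (W : Submodule K U) :
    Module.finrank K (W.comap π) = Module.finrank K W + Module.finrank K (LinearMap.ker π) := by
  have : Module.Finite K V := Module.Finite.of_finite
  have h := LinearMap.finrank_range_add_finrank_ker (π.domRestrict (W.comap π))
  rw [LinearMap.range_domRestrict, LinearMap.ker_domRestrict, Submodule.map_comap_eq_of_surjective hπ] at h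
  rw [← h]
  congr 1
  refine LinearEquiv.finrank_eq (Submodule.comapSubtypeEquivOfLe ?_)
  intro x hx
  simp [LinearMap.mem_ker.1 hx]

lemma sumOn_span (f : V → ZMod p) (y : V) (hy : y ≠ 0) :
    sumOn f (Submodule.span K {y}) = ∑ a : K, f (a • y) := by
  unfold sumOn
  rw [← Finset.sum_filter]
  symm
  refine Finset.sum_bij (fun a _ => a • y) ?_ ?_ ?_ ?_
  · intro a _
    simpa using Submodule.smul_mem _ a (Submodule.mem_span_singleton_self y)
  · intro a _ b _ h
    exact smul_left_injective K hy h
  · intro v hv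
    simp only [Finset.mem_filter, Finset.mem_univ, true_and] at hv
    obtain ⟨a, ha⟩ := Submodule.mem_span_singleton.1 hv
    exact ⟨a, Finset.mem_univ _, ha⟩
  · intros; rfl

lemma sumOn_span_homog [Fact p.Prime] [CharP K p] (f : V → ZMod p)
    (hf : ∀ (a : K) (v : V), a ≠ 0 → f (a • v) = f v) (y : V) (hy : y ≠ 0) :
    sumOn f (Submodule.span K {y}) = f 0 - f y := by
  rw [sumOn_span f y hy, ← Finset.add_sum_erase _ _ (Finset.mem_univ (0 : K)), zero_smul]
  rw [Finset.sum_congr rfl (g := fun _ => f y) (fun a ha => hf a y (Finset.ne_of_mem_erase ha))]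
  have hq : ((Fintype.card K : ℕ) : ZMod p) = 0 := by
    rw [ZMod.natCast_eq_zero_iff]
    exact (CharP.cast_eq_zero_iff K p _).1 (by simp)
  have h1 : 1 ≤ Fintype.card K := Fintype.card_pos
  rw [Finset.sum_const, Finset.card_erase_of_mem (Finset.mem_univ _), Finset.card_univ,
    nsmul_eq_mul, Nat.cast_sub h1, hq]
  ring

lemma card_sub_zero [Fact p.Prime] [CharP K p] (W : Submodule K V)
    (hW : 0 < Module.finrank K W) :
    sumOn (fun _ => (1 : ZMod p)) W = 0 := by
  have hq : ((Fintype.card K : ℕ) : ZMod p) = 0 := by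
    rw [ZMod.natCast_eq_zero_iff]
    exact (CharP.cast_eq_zero_iff K p _).1 (by simp)
  unfold sumOn
  rw [Finset.sum_boole]
  have : (Finset.univ.filter fun v => v ∈ W).card = Fintype.card W := by
    rw [Fintype.card_subtype]
  rw [this, Module.card_eq_pow_finrank (K := K), Nat.cast_pow, hq, zero_pow hW.ne']

lemma sum_ge_two [Fact p.Prime] [CharP K p] (f : V → ZMod p) (hf : Good K 1 f)
    (W : Submodule K V) (hW : 2 ≤ Module.finrank K W) : sumOn f W = 0 := by
  have : Module.Finite K V := Module.Finite.of_finite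
  obtain ⟨P, hPW, hP⟩ := W.exists_mem_ne_zero_of_ne_bot (by
    rintro rfl
    simp at hW)
  have : Finite (V ⧸ Submodule.span K {P}) := Quotient.finite _
  let _ : Fintype (V ⧸ Submodule.span K {P}) := Fintype.ofFinite _
  set π := (Submodule.span K {P}).mkQ with hπ
  have hs : Function.Surjective π := Submodule.mkQ_surjective _
  have hker : LinearMap.ker π = Submodule.span K {P} := Submodule.ker_mkQ _
  have hk1 : Module.finrank K (LinearMap.ker π) = 1 := by
    rw [hker]; exact finrank_span_singleton hP
  have hconst : ∀ y, push π f y = push π f 0 := by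
    intro y
    by_cases hy : y = 0
    · rw [hy]
    have h1 := sumOn_span_homog (push π f) (push_smul π f hf.smul) y hy
    rw [push_sumOn, hf.sum _ (by rw [finrank_comap_surj π hs, hk1, finrank_span_singleton hy])] at h1
    exact (sub_eq_zero.1 h1.symm).symm
  have hcm : (W.map π).comap π = W := by
    rw [Submodule.comap_map_eq, hker, sup_eq_left, Submodule.span_singleton_le_iff_mem]
    exact hPW
  have hfr := finrank_comap_surj π hs (W.map π)
  rw [hcm, hk1] at hfr
  rw [← hcm, ← push_sumOn]
  have h2 := card_sub_zero (p := p) (W.map π) (by omega)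
  unfold sumOn at h2 ⊢
  simp_rw [hconst]
  have : ∀ v, (if v ∈ W.map π then push π f 0 else 0)
      = push π f 0 * (if v ∈ W.map π then 1 else 0) := by
    intro v; simp
  simp_rw [this]
  rw [← Finset.mul_sum, h2, mul_zero]

/-- Embedding direction. -/
lemma good_embed [Fact p.Prime] [CharP K p] (ι : V →ₗ[K] U) (hι : Function.Injective ι)
    (k : ℕ) (hk : Module.finrank K V + k = Module.finrank K U + 1)
    (f : V → ZMod p) (hf : Good K 1 f) (hf0 : f ≠ 0) :
    ∃ g : U → ZMod p, Good K k g ∧ g ≠ 0 ∧ wt g ≤ wt f := by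
  have : Module.Finite K V := Module.Finite.of_finite
  have : Module.Finite K U := Module.Finite.of_finite
  have hval : ∀ v, push ι f (ι v) = f v := by
    intro v
    simp [push, hι.eq_iff]
  refine ⟨push ι f, ⟨?_, push_smul ι f hf.smul, ?_⟩, ?_, push_wt ι f⟩
  · rw [← map_zero ι, hval, hf.zero]
  · intro W hW
    rw [push_sumOn]
    apply sum_ge_two f hf
    have h1 := Submodule.finrank_sup_add_finrank_inf_eq W (LinearMap.range ι)
    have h2 := Submodule.finrank_le (W ⊔ LinearMap.range ι)
    have h3 := LinearMap.finrank_range_of_inj hι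
    have h4 : Module.finrank K (W.comap ι) = Module.finrank K (W ⊓ LinearMap.range ι : Submodule K U) := by
      rw [inf_comm, ← Submodule.map_comap_eq]
      exact (Submodule.equivMapOfInjective ι hι _).finrank_eq
    omega
  · intro h0
    apply hf0
    ext v
    rw [← hval, h0]
    rfl

lemma wt_lt_card (f : V → ZMod p) (h0 : f 0 = 0) : wt f < Fintype.card V := by
  unfold wt
  rw [← Finset.card_univ]
  apply Finset.card_lt_card
  rw [Finset.filter_ssubset]
  exact ⟨0, Finset.mem_univ _, by simpa using h0⟩

/-- Projection step. -/
lemma good_project [Fact p.Prime] [CharP K p] (k : ℕ)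
    (f : V → ZMod p) (hf : Good K (k + 1) f) (hf0 : f ≠ 0)
    (hcard : wt f * Fintype.card K < Fintype.card V)
    (hdim : Module.finrank K V = Module.finrank K U + 1) :
    ∃ g : U → ZMod p, Good K k g ∧ g ≠ 0 ∧ wt g ≤ wt f := by
  have : Module.Finite K V := Module.Finite.of_finite
  have : Module.Finite K U := Module.Finite.of_finite
  obtain ⟨P, hP⟩ := Function.ne_iff.1 hf0
  have hP : f P ≠ 0 := hP
  have hP0 : P ≠ 0 := by rintro rfl; exact hP hf.zero
  -- a vector `u` none of whose translates by multiples of `P` lies in the support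
  obtain ⟨u, hu⟩ : ∃ u : V, ∀ a : K, f (u + a • P) = 0 := by
    by_contra! hcon
    have : (Finset.univ : Finset V) ⊆
        ((Finset.univ.filter fun x => f x ≠ 0) ×ˢ (Finset.univ : Finset K)).image
          (fun x => x.1 - x.2 • P) := by
      intro u _
      obtain ⟨a, ha⟩ := hcon u
      simp only [Finset.mem_image, Finset.mem_product, Finset.mem_filter, Finset.mem_univ,
        true_and, and_true, Prod.exists]
      exact ⟨u + a • P, a, ha, by simp⟩
    have h2 := (Finset.card_le_card this).trans Finset.card_image_le
    rw [Finset.card_product, Finset.card_univ, Finset.card_univ] at h2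
    unfold wt at hcard
    omega
  have hu0 : u ≠ 0 := by
    rintro rfl
    exact hP (by simpa using hu 1)
  have hq : Module.finrank K (V ⧸ Submodule.span K {u}) = Module.finrank K U := by
    have := Submodule.finrank_quotient_add_finrank (Submodule.span K {u})
    rw [finrank_span_singleton hu0] at this
    omega
  let e := LinearEquiv.ofFinrankEq _ _ hq
  let π : V →ₗ[K] U := e.toLinearMap ∘ₗ (Submodule.span K {u}).mkQ
  have hs : Function.Surjective π := e.surjective.comp (Submodule.mkQ_surjective _)
  have hker : LinearMap.ker π = Submodule.span K {u} := by
    simp [π, LinearMap.ker_comp]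
  have hk1 : Module.finrank K (LinearMap.ker π) = 1 := by
    rw [hker]; exact finrank_span_singleton hu0
  refine ⟨push π f, ⟨?_, push_smul π f hf.smul, ?_⟩, ?_, push_wt π f⟩
  · have h1 : push π f 0 = sumOn f (Submodule.span K {u}) := by
      unfold push sumOn
      rw [← hker]
      rfl
    rw [h1, sumOn_span_homog f hf.smul u hu0, hf.zero]
    have := hu 0
    simp at this
    simp [this]
  · intro W hW
    rw [push_sumOn]
    apply hf.sum
    rw [finrank_comap_surj π hs, hW, hk1]
  · intro h0
    have h1 : push π f (π P) = f P := by
      unfold push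
      rw [Finset.sum_eq_single P]
      · simp
      · intro v _ hv
        split_ifs with h
        · have hm : v - P ∈ LinearMap.ker π := by simp [h]
          rw [hker] at hm
          obtain ⟨a, ha⟩ := Submodule.mem_span_singleton.1 hm
          have ha0 : a ≠ 0 := by
            rintro rfl
            apply hv
            rw [zero_smul] at ha
            exact sub_eq_zero.1 ha.symm
          have hv2 : v = a • (u + a⁻¹ • P) := by
            rw [smul_add, smul_smul, mul_inv_cancel₀ ha0, one_smul, ha]
            simp
          rw [hv2, hf.smul _ _ ha0, hu]
        · rfl
      · simp
    rw [h0] at h1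
    exact hP h1.symm

/-- The difference of two hyperplanes. -/
lemma exists_good [Fact p.Prime] [CharP K p] (m : ℕ) :
    ∃ g : (Fin (m + 2) → K) → ZMod p, Good K 1 g ∧ g ≠ 0 := by
  let φ : Fin (m + 2) → (Fin (m + 2) → K) →ₗ[K] K := fun i => LinearMap.proj i
  have key : ∀ (i) (W : Submodule K (Fin (m + 2) → K)), Module.finrank K W = 2 →
      sumOn (fun v => if v i = 0 then (1 : ZMod p) else 0) W = 0 := by
    intro i W hW
    have h1 := Submodule.finrank_sup_add_finrank_inf_eq W (LinearMap.ker (φ i))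
    have h2 := Submodule.finrank_le (W ⊔ LinearMap.ker (φ i))
    have h3 := LinearMap.finrank_range_add_finrank_ker (φ i)
    have h4 := Submodule.finrank_le (LinearMap.range (φ i))
    rw [Module.finrank_self] at h4
    refine Eq.trans ?_ (card_sub_zero (p := p) (W ⊓ LinearMap.ker (φ i)) (by omega))
    unfold sumOn
    refine Finset.sum_congr rfl fun v _ => ?_
    by_cases h5 : v ∈ W <;> simp [h5, φ]
  refine ⟨fun v => (if v 0 = 0 then 1 else 0) - (if v 1 = 0 then 1 else 0), ⟨?_, ?_, ?_⟩, ?_⟩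
  · simp
  · intro a v ha
    simp [ha]
  · intro W hW
    have h0 := key 0 W hW
    have h1 := key 1 W hW
    unfold sumOn at *
    have h2 := congrArg₂ (· - ·) h0 h1
    simp only [sub_zero] at h2
    rw [← Finset.sum_sub_distrib] at h2
    refine Eq.trans ?_ h2
    refine Finset.sum_congr rfl fun v _ => ?_
    by_cases h5 : v ∈ W <;> simp [h5]
  · intro h
    have := congrFun h (Pi.single 0 1)
    simp at this

/-- Projection direction. -/
lemma good_down [Fact p.Prime] [CharP K p] (m : ℕ) (k : ℕ) :
    ∀ (f : (Fin (m + 2 + k) → K) → ZMod p), Good K (k + 1) f → f ≠ 0 →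
    ∃ g : (Fin (m + 2) → K) → ZMod p, Good K 1 g ∧ g ≠ 0 ∧ wt g ≤ wt f := by
  induction k with
  | zero => intro f hf hf0; exact ⟨f, hf, hf0, le_rfl⟩
  | succ k ih =>
    intro f hf hf0
    obtain ⟨g0, hg0, hg0'⟩ := exists_good (p := p) (K := K) m
    by_cases hle : wt g0 ≤ wt f
    · exact ⟨g0, hg0, hg0', hle⟩
    have hlt := wt_lt_card g0 hg0.zero
    obtain ⟨g, hg, hgne, hgw⟩ := good_project (U := Fin (m + 2 + k) → K) (k + 1) f hf hf0 (by
      rw [Fintype.card_fun, Fintype.card_fin] at hlt ⊢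
      have hq : 0 < Fintype.card K := Fintype.card_pos
      calc wt f * Fintype.card K < Fintype.card K ^ (m + 2) * Fintype.card K :=
            Nat.mul_lt_mul_of_pos_right (by omega) hq
        _ = Fintype.card K ^ (m + 2 + 1) := (pow_succ _ _).symm
        _ ≤ _ := Nat.pow_le_pow_right hq (by omega)) (by simp; ring)
    obtain ⟨g', h1, h2, h3⟩ := ih g hg hgne
    exact ⟨g', h1, h2, h3.trans hgw⟩

/-- Lift of a function on points to the vector space. -/
def lift0 {M : Type} [Zero M] (c : Projectivization K V → M) (v : V) : M :=
  if hv : v = 0 then 0 else c (Projectivization.mk K v hv)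

lemma sum_lift0 {M : Type} [AddCommMonoid M] [Fintype (Projectivization K V)]
    (c : Projectivization K V → M) :
    ∑ v, lift0 c v = (Fintype.card K - 1) • ∑ P, c P := by
  have hb : Function.Bijective (fun x : Projectivization K V × Kˣ =>
      (⟨x.2 • x.1.rep, (smul_ne_zero_iff_ne _).2 x.1.rep_nonzero⟩ : {v : V // v ≠ 0})) := by
    constructor
    · rintro ⟨P, a⟩ ⟨Q, b⟩ h
      simp only [Subtype.mk.injEq] at h
      have hPQ : P = Q := by
        rw [← P.mk_rep, ← Q.mk_rep, Projectivization.mk_eq_mk_iff]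
        exact ⟨a⁻¹ * b, by rw [mul_smul, ← h, inv_smul_smul]⟩
      subst hPQ
      have : a = b := Units.ext (smul_left_injective K P.rep_nonzero h)
      rw [this]
    · rintro ⟨v, hv⟩
      obtain ⟨a, ha⟩ := Projectivization.exists_smul_eq_mk_rep K v hv
      exact ⟨(Projectivization.mk K v hv, a⁻¹), by simp [← ha]⟩
  have h1 : ∑ v, lift0 c v = ∑ v : {v : V // v ≠ 0}, lift0 c v.1 := by
    rw [← Finset.sum_filter_of_ne (p := fun v : V => v ≠ 0)]
    · exact Finset.sum_subtype _ (by simp) _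
    · rintro v _ hv rfl
      simp [lift0] at hv
  rw [h1, ← Fintype.sum_bijective _ hb (fun x => c x.1) _ ?_]
  · rw [Fintype.sum_prod_type]
    simp [Fintype.card_units, Finset.smul_sum]
  · rintro ⟨P, a⟩
    have h0 : a • P.rep ≠ 0 := (smul_ne_zero_iff_ne _).2 P.rep_nonzero
    simp only [lift0, h0, dite_false]
    congr 1
    conv_lhs => rw [← P.mk_rep]
    rw [Projectivization.mk_eq_mk_iff]
    exact ⟨a⁻¹, by simp⟩

lemma lift0_mul_inc [Fintype (Projectivization K V)] (c : Projectivization K V → ZMod p)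
    (W : Submodule K V) :
    sumOn (lift0 c) W = (Fintype.card K - 1) •
      ∑ P : Projectivization K V, c P * (if P.submodule ≤ W then 1 else 0) := by
  rw [← sum_lift0]
  unfold sumOn
  refine Finset.sum_congr rfl fun v _ => ?_
  by_cases hv : v = 0
  · simp [lift0, hv]
  · simp [lift0, hv, Projectivization.submodule_mk, Submodule.span_singleton_le_iff_mem]

lemma wt_lift0 [Fintype (Projectivization K V)] (c : Projectivization K V → ZMod p) :
    wt (lift0 c) = (Fintype.card K - 1) * wt c := by
  have h := sum_lift0 (K := K) (V := V) (fun P => if c P ≠ 0 then (1 : ℕ) else 0)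
  unfold wt
  rw [Finset.card_filter, Finset.card_filter, ← smul_eq_mul, ← h]
  refine Finset.sum_congr rfl fun v _ => ?_
  by_cases hv : v = 0
  · simp [lift0, hv]
  · simp [lift0, hv]

lemma lift0_smul (c : Projectivization K V → ZMod p) (a : K) (v : V) (ha : a ≠ 0) :
    lift0 c (a • v) = lift0 c v := by
  by_cases hv : v = 0
  · simp [hv]
  · have h0 : a • v ≠ 0 := smul_ne_zero ha hv
    simp only [lift0, h0, hv, dite_false]
    congr 1
    rw [Projectivization.mk_eq_mk_iff']
    exact ⟨a, rfl⟩

lemma lift0_rep (f : V → ZMod p) (h0 : f 0 = 0)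
    (hf : ∀ (a : K) (v : V), a ≠ 0 → f (a • v) = f v) :
    lift0 (fun P : Projectivization K V => f P.rep) = f := by
  ext v
  by_cases hv : v = 0
  · simp [lift0, hv, h0]
  · simp only [lift0, hv, dite_false]
    obtain ⟨a, ha⟩ := Projectivization.exists_smul_eq_mk_rep K v hv
    rw [← ha]
    exact hf a v a.ne_zero

lemma lift0_ne (c : Projectivization K V → ZMod p) : lift0 c ≠ 0 ↔ c ≠ 0 := by
  rw [not_iff_not]
  constructor
  · intro h
    ext P
    have := congrFun h P.rep
    simpa [lift0, P.rep_nonzero] using this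
  · rintro rfl
    ext v
    simp [lift0]

end aux

lemma mem_dual_iff (p h n k : ℕ) [Fact p.Prime] [Fintype (GaloisField p h)]
    (c : PGPoint p h n → ZMod p) :
    c ∈ dualCode (PGCode p h n k) ↔ Good (GaloisField p h) k (lift0 c) := by
  have hq : ((Fintype.card (GaloisField p h) : ℕ) : ZMod p) = 0 := by
    rw [ZMod.natCast_eq_zero_iff]
    exact (CharP.cast_eq_zero_iff (GaloisField p h) p _).1 (by simp)
  have hone : 1 ≤ Fintype.card (GaloisField p h) := Fintype.card_pos
  have hW : ∀ W, sumOn (lift0 c) W = - ip c (incVec p h n W) := by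
    intro W
    rw [lift0_mul_inc, nsmul_eq_mul, Nat.cast_sub hone, hq]
    simp [ip, incVec]
  constructor
  · intro hc
    refine ⟨by simp [lift0], fun a v ha => lift0_smul c a v ha, fun W hWr => ?_⟩
    rw [hW, hc _ (Submodule.subset_span ⟨W, hWr, rfl⟩), neg_zero]
  · intro hg d hd
    unfold PGCode at hd
    induction hd using Submodule.span_induction with
    | mem x hx =>
      obtain ⟨W, hWr, rfl⟩ := hx
      exact neg_eq_zero.1 ((hW W).symm.trans (hg.sum W hWr))
    | zero => simp [ip]
    | add x y _ _ hx hy =>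
      simp only [ip, Pi.add_apply, mul_add, Finset.sum_add_distrib] at *
      rw [hx, hy, add_zero]
    | smul a x _ hx =>
      simp only [ip, Pi.smul_apply, smul_eq_mul, mul_left_comm _ a, ← Finset.mul_sum] at *
      rw [hx, mul_zero]

lemma transfer (p h n k n' k' : ℕ) [Fact p.Prime] [Fintype (GaloisField p h)]
    (H : ∀ f : (Fin (n + 1) → GaloisField p h) → ZMod p, Good (GaloisField p h) k f → f ≠ 0 →
      ∃ g : (Fin (n' + 1) → GaloisField p h) → ZMod p,
        Good (GaloisField p h) k' g ∧ g ≠ 0 ∧ wt g ≤ wt f) :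
    ∀ w ∈ { w | ∃ c ∈ dualCode (PGCode p h n k), c ≠ 0 ∧ wt c = w },
      ∃ w' ∈ { w | ∃ c ∈ dualCode (PGCode p h n' k'), c ≠ 0 ∧ wt c = w }, w' ≤ w := by
  rintro w ⟨c, hc, hc0, rfl⟩
  obtain ⟨g, hg, hg0, hgw⟩ := H (lift0 c) ((mem_dual_iff p h n k c).1 hc) ((lift0_ne c).2 hc0)
  have hl := lift0_rep g hg.zero hg.smul
  refine ⟨_, ⟨fun P => g P.rep, ?_, ?_, rfl⟩, ?_⟩
  · rw [mem_dual_iff, hl]; exact hg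
  · rw [← lift0_ne, hl]; exact hg0
  · rw [← hl, wt_lift0, wt_lift0] at hgw
    have h1 : 1 < Fintype.card (GaloisField p h) := Fintype.one_lt_card
    exact Nat.le_of_mul_le_mul_left hgw (by omega)

lemma sInf_le_of_dom (S T : Set ℕ) (hS : S.Nonempty) (h : ∀ w ∈ S, ∃ w' ∈ T, w' ≤ w) :
    sInf T ≤ sInf S := by
  obtain ⟨w', hw', hle⟩ := h _ (Nat.sInf_mem hS)
  exact (Nat.sInf_le hw').trans hle

lemma sInf_eq_of_dom (S T : Set ℕ) (h : ∀ w ∈ S, ∃ w' ∈ T, w' ≤ w)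
    (h' : ∀ w ∈ T, ∃ w' ∈ S, w' ≤ w) : sInf S = sInf T := by
  by_cases hS : S.Nonempty
  · have hT : T.Nonempty := by
      obtain ⟨w, hw⟩ := hS
      obtain ⟨w', hw', _⟩ := h w hw
      exact ⟨w', hw'⟩
    exact le_antisymm (sInf_le_of_dom T S hT h') (sInf_le_of_dom S T hS h)
  · have hT : ¬ T.Nonempty := by
      rintro ⟨w, hw⟩
      obtain ⟨w', hw', _⟩ := h' w hw
      exact hS ⟨w', hw'⟩
    rw [Set.not_nonempty_iff_eq_empty.1 hS, Set.not_nonempty_iff_eq_empty.1 hT]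

/-- `d(C_k(n,q)^⊥) = d(C_1(n-k+1,q)^⊥)` for `n ≥ 2`, `0 < k ≤ n-1`. -/
theorem stmt16 (p h n k : ℕ) [Fact p.Prime] (hh : 0 < h) (hn : 2 ≤ n)
    (hk1 : 0 < k) (hkn : k ≤ n - 1) :
    minWt (dualCode (PGCode p h n k)) = minWt (dualCode (PGCode p h (n-k+1) 1)) := by
  have : Finite (GaloisField p h) := inferInstance
  let _ : Fintype (GaloisField p h) := Fintype.ofFinite _
  obtain ⟨j, rfl⟩ : ∃ j, k = j + 1 := ⟨k - 1, by omega⟩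
  obtain ⟨m, rfl⟩ : ∃ m, n = m + 1 + j := ⟨n - 1 - j, by omega⟩
  have hm : m + 1 + j - (j + 1) + 1 = m + 1 := by omega
  rw [hm]
  apply sInf_eq_of_dom
  · apply transfer
    have hidx : m + 1 + j + 1 = m + 2 + j := by omega
    rw [hidx]
    exact good_down m j
  · apply transfer
    intro f hf hf0
    have hle : m + 1 + 1 ≤ m + 1 + j + 1 := by omega
    refine good_embed (Function.ExtendByZero.linearMap (GaloisField p h) (Fin.castLE hle)) ?_ (j + 1)
      ?_ f hf hf0
    · intro x y hxy
      ext i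
      have h1 : Function.extend (Fin.castLE hle) x 0 (Fin.castLE hle i)
          = Function.extend (Fin.castLE hle) y 0 (Fin.castLE hle i) :=
        congrFun hxy (Fin.castLE hle i)
      rwa [(Fin.castLE_injective hle).extend_apply, (Fin.castLE_injective hle).extend_apply] at h1
    · simp; ring
end
end
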